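/- Let G be a finite group, z an element of order 2 modulo Z(G) (z ∉ Z(G), z² ∈ Z(G)) that is not contained in any normal 2-subgroup modulo the center. Then there exists h ∈ G such that the image of ⟨z, z^h⟩ in G/Z(G) is a dihedral group of order 2n with n odd, and z inverts the cyclic subgroup ⟨z·z^h⟩Z(G)/Z(G). -/

import Mathlib

section BaerSuzuki

open Subgroup Group

/-- If a `p`-subgroup `P` contains elements of a conjugation-invariant set `K` outside a subgroup
`T`, then one of these elements normalizes `P ∩ T ∩ K`. -/
lemma IsPGroup.exists_mem_normalizer_notMem {G : Type*} [Group G] [Finite G] {p : ℕ}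
    [Fact p.Prime] {P : Subgroup G} (hP : IsPGroup p P) (T : Subgroup G) {K : Set G}
    (hK : ∀ g, ∀ k ∈ K, g * k * g⁻¹ ∈ K) (hPT : ¬ (P : Set G) ∩ K ⊆ T) :
    ∃ u ∈ P, u ∈ K ∧ u ∉ T ∧ u ∈ normalizer ((P : Set G) ∩ T ∩ K) := by
  have hK' : ∀ g k, g * k * g⁻¹ ∈ K ↔ k ∈ K := fun g k =>
    ⟨fun h => by simpa [mul_assoc] using hK g⁻¹ _ h, hK g k⟩
  obtain ⟨M, hTM, hM⟩ := (Set.toFinite {M : Subgroup P | T.subgroupOf P ≤ M ∧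
    ∀ m ∈ M, (m : G) ∈ K → (m : G) ∈ T}).exists_le_maximal
    (a := T.subgroupOf P) ⟨le_rfl, fun m hm _ => hm⟩
  have hM_ne : M ≠ ⊤ := by
    rintro rfl
    exact hPT fun u hu => hM.prop.2 ⟨u, hu.1⟩ (mem_top _) hu.2
  have := hP.isNilpotent
  have hlt := Group.normalizerCondition_of_isNilpotent M (lt_top_iff_ne_top.2 hM_ne)
  obtain ⟨u, huN, huK, huT⟩ : ∃ u ∈ normalizer (M : Set P), (u : G) ∈ K ∧ (u : G) ∉ T := by
    by_contra! h
    exact hlt.not_ge (hM.le_of_ge ⟨hTM.trans hlt.le, h⟩ hlt.le)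
  refine ⟨u, u.2, huK, huT, ?_⟩
  have key : ∀ k : P, (k : G) ∈ K → ((k : G) ∈ T ↔ k ∈ M) := fun k hk =>
    ⟨fun h => hTM h, fun h => hM.prop.2 k h hk⟩
  rw [mem_set_normalizer_iff]
  intro k
  have hkP : (u : G) * k * (u : G)⁻¹ ∈ P ↔ k ∈ P := by
    rw [P.mul_mem_cancel_right (P.inv_mem u.2), P.mul_mem_cancel_left u.2]
  simp only [Set.mem_inter_iff, SetLike.mem_coe, hkP, hK', and_assoc]
  refine and_congr_right fun hk => and_congr_left fun hkK => ?_
  have := mem_normalizer_iff.1 huN ⟨k, hk⟩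
  rw [key ⟨k, hk⟩ hkK, this, ← key _ ((hK' _ _).2 hkK)]
  rfl

/-- If any two elements of a conjugation-invariant set `K` of `p`-elements generate a `p`-group,
then all Sylow `p`-subgroups meet `K` in the same set. -/
lemma Sylow.inter_eq_inter_of_isPGroup_closure_pair {G : Type*} [Group G] [Finite G] {p : ℕ}
    [Fact p.Prime] {K : Set G} (hK : ∀ g, ∀ k ∈ K, g * k * g⁻¹ ∈ K)
    (hpair : ∀ a ∈ K, ∀ b ∈ K, IsPGroup p (closure {a, b})) (P Q : Sylow p G) :
    (P : Set G) ∩ K = (Q : Set G) ∩ K := by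
  have not_subset : ∀ P Q : Sylow p G, (P : Set G) ∩ K ≠ (Q : Set G) ∩ K →
      ¬ (P : Set G) ∩ K ⊆ (Q : Subgroup G) := by
    intro P Q hne hsub
    refine hne (Set.eq_of_subset_of_ncard_le (Set.subset_inter hsub Set.inter_subset_right) ?_)
    obtain ⟨g, rfl⟩ := MulAction.exists_smul_eq G Q P
    refine Set.ncard_le_ncard_of_injOn (fun k => g * k * g⁻¹) ?_ (by intro a _ b _; simp)
    rintro k ⟨hkQ, hkK⟩
    refine ⟨?_, hK g k hkK⟩
    rw [Sylow.coe_smul]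
    exact ⟨k, hkQ, rfl⟩
  by_contra hPQ
  obtain ⟨⟨P, Q⟩, hne, hmax⟩ := Set.exists_max_image
    {R : Sylow p G × Sylow p G | (R.1 : Set G) ∩ K ≠ (R.2 : Set G) ∩ K}
    (fun R => ((R.1 : Set G) ∩ R.2 ∩ K).ncard) (Set.toFinite _) ⟨(P, Q), hPQ⟩
  simp only [Set.mem_ofPred_eq, Prod.forall] at hne hmax
  obtain ⟨u, huP, huK, huQ, hu⟩ :=
    P.2.exists_mem_normalizer_notMem Q hK (not_subset P Q hne)
  obtain ⟨v, hvQ, hvK, hvP, hv⟩ :=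
    Q.2.exists_mem_normalizer_notMem P hK (not_subset Q P hne.symm)
  set S : Set G := (P : Set G) ∩ Q ∩ K with hS
  have hv' : v ∈ normalizer S := by
    rw [hS, Set.inter_comm (P : Set G)]
    exact hv
  have hle : closure {u, v} ≤ normalizer (closure S : Set G) := by
    refine le_trans ?_ (normalizer_le_normalizer_closure S)
    rw [closure_le, Set.pair_subset_iff]
    exact ⟨hu, hv'⟩
  have hSp : IsPGroup p (closure S) :=
    P.2.to_le ((closure_le _).2 fun s hs => hs.1.1)
  obtain ⟨R, hR⟩ :=
    ((hpair u huK v hvK).to_sup_of_normal_right' hSp hle).exists_le_sylow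
  have hSR : S ⊆ R := fun s hs => hR (mem_sup_right (subset_closure hs))
  have huR : u ∈ R := hR (mem_sup_left (subset_closure (by simp)))
  have hvR : v ∈ R := hR (mem_sup_left (subset_closure (by simp)))
  have hPR : (P : Set G) ∩ K = (R : Set G) ∩ K := by
    by_contra h
    have hsub : S ⊆ (P : Set G) ∩ R ∩ K := fun s hs => ⟨⟨hs.1.1, hSR hs⟩, hs.2⟩
    exact (hmax P R h).not_gt (Set.ncard_lt_ncard ((Set.ssubset_iff_of_subset hsub).2
      ⟨u, ⟨⟨huP, huR⟩, huK⟩, fun h => huQ h.1.2⟩))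
  exact hvP ((Set.ext_iff.1 hPR v).2 ⟨hvR, hvK⟩).1

/-- The **Baer–Suzuki theorem**: if any two conjugates of `x` generate a `p`-group, then so do
all conjugates of `x` together. -/
theorem isPGroup_normalClosure_of_isPGroup_closure_pair {G : Type*} [Group G] [Finite G] {p : ℕ}
    [Fact p.Prime] {x : G} (hx : ∀ g : G, IsPGroup p (closure {x, g⁻¹ * x * g})) :
    IsPGroup p (normalClosure {x}) := by
  have hK : ∀ g : G, ∀ k ∈ conjugatesOfSet {x}, g * k * g⁻¹ ∈ conjugatesOfSet {x} :=
    fun g k hk => conj_mem_conjugatesOfSet hk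
  have hpair : ∀ a ∈ conjugatesOfSet {x}, ∀ b ∈ conjugatesOfSet {x},
      IsPGroup p (closure {a, b}) := by
    simp only [mem_conjugatesOfSet_iff, Set.mem_singleton_iff, exists_eq_left, isConj_iff]
    rintro _ ⟨g, rfl⟩ _ ⟨h, rfl⟩
    have hgh := (hx (h⁻¹ * g)).map (MulAut.conj g).toMonoidHom
    rw [MonoidHom.map_closure, Set.image_pair] at hgh
    have hconj : g * ((h⁻¹ * g)⁻¹ * x * (h⁻¹ * g)) * g⁻¹ = h * x * h⁻¹ := by group
    rw [← hconj]
    exact hgh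
  obtain ⟨P⟩ : Nonempty (Sylow p G) := inferInstance
  refine P.2.to_le ((closure_le _).2 fun k hk => ?_)
  obtain ⟨Q, hQ⟩ := (hpair k hk k hk).exists_le_sylow
  exact ((Set.ext_iff.1 (Sylow.inter_eq_inter_of_isPGroup_closure_pair hK hpair P Q) k).2
    ⟨hQ (subset_closure (by simp)), hk⟩).1

section Involutions

variable {G : Type*} [Group G]

lemma conj_mul_eq_inv_of_sq_eq_one {x y : G} (hx : x ^ 2 = 1) (hy : y ^ 2 = 1) :
    x * (x * y) * x⁻¹ = (x * y)⁻¹ := by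
  rw [sq] at hx hy
  rw [← mul_assoc, hx, one_mul, mul_inv_rev, inv_eq_of_mul_eq_one_left hy]

lemma conj_zpow_eq_inv {x c : G} (h : x * c * x⁻¹ = c⁻¹) (k : ℤ) :
    x * c ^ k * x⁻¹ = c ^ (-k) := by
  rw [← conj_zpow, h, inv_zpow']

lemma closure_pair_eq_zpowers_sup_zpowers (x y : G) :
    closure {x, y} = zpowers x ⊔ zpowers (x * y) := by
  apply le_antisymm
  · rw [closure_le, Set.pair_subset_iff]
    have hx : x ∈ zpowers x ⊔ zpowers (x * y) := mem_sup_left (mem_zpowers x)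
    refine ⟨hx, ?_⟩
    simpa using mul_mem (inv_mem hx) (mem_sup_right (mem_zpowers (x * y)))
  · have hx : x ∈ closure {x, y} := subset_closure (by simp)
    simp only [sup_le_iff, zpowers_le]
    exact ⟨hx, mul_mem hx (subset_closure (by simp))⟩

lemma isPGroup_zpowers {p k : ℕ} {g : G} (hg : g ^ p ^ k = 1) : IsPGroup p (zpowers g) := by
  rintro ⟨_, n, rfl⟩
  refine ⟨k, Subtype.ext ?_⟩
  change (g ^ n) ^ p ^ k = 1
  rw [← zpow_natCast, zpow_comm, zpow_natCast, hg, one_zpow]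

/-- Two involutions whose product has order a power of two generate a `2`-group. -/
lemma isPGroup_closure_pair_of_sq_eq_one {x y : G} (hx : x ^ 2 = 1) (hy : y ^ 2 = 1) {k : ℕ}
    (hk : (x * y) ^ 2 ^ k = 1) : IsPGroup 2 (closure {x, y}) := by
  rw [closure_pair_eq_zpowers_sup_zpowers]
  refine (isPGroup_zpowers (k := 1) (by simpa using hx)).to_sup_of_normal_right'
    (isPGroup_zpowers hk) ?_
  rw [zpowers_le, mem_normalizer_iff_map_conj_eq, MonoidHom.map_zpowers]
  change zpowers (x * (x * y) * x⁻¹) = _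
  rw [conj_mul_eq_inv_of_sq_eq_one hx hy, zpowers_inv]

/-- The homomorphism from the dihedral group of order `2 * orderOf c` determined by an involution
`x` inverting `c`. -/
noncomputable def DihedralGroup.liftOfConjEqInv {x c : G} (hx : x ^ 2 = 1)
    (h : x * c * x⁻¹ = c⁻¹) : DihedralGroup (orderOf c) →* G := by
  have hadd (i j : ZMod (orderOf c)) :
      c ^ ((i + j).cast : ℤ) = c ^ (i.cast : ℤ) * c ^ (j.cast : ℤ) := by
    rw [← zpow_add, zpow_eq_zpow_iff_modEq, ← ZMod.intCast_eq_intCast_iff]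
    simp
  have hsub (i j : ZMod (orderOf c)) :
      c ^ ((i - j).cast : ℤ) = c ^ (-j.cast : ℤ) * c ^ (i.cast : ℤ) := by
    rw [← zpow_add, zpow_eq_zpow_iff_modEq, ← ZMod.intCast_eq_intCast_iff]
    simp [sub_eq_neg_add]
  have hswap (k : ℤ) : c ^ k * x = x * c ^ (-k) := by
    rw [← mul_inv_eq_iff_eq_mul.1 ((conj_zpow_eq_inv h (-k)).trans (by rw [neg_neg]))]
  exact
  { toFun := fun
      | .r i => c ^ (i.cast : ℤ)
      | .sr i => x * c ^ (i.cast : ℤ)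
    map_one' := by simp [DihedralGroup.one_def, -DihedralGroup.r_zero]
    map_mul' := by
      rintro (i | i) (j | j)
      · simp [hadd]
      · simp only [DihedralGroup.r_mul_sr, hsub, ← mul_assoc, hswap]
      · simp [hadd, mul_assoc]
      · simp only [DihedralGroup.sr_mul_sr, hsub]
        rw [mul_assoc x, ← mul_assoc _ x, hswap, ← mul_assoc, ← mul_assoc, ← sq, hx, one_mul] }

lemma DihedralGroup.liftOfConjEqInv_injective {x c : G} (hx : x ^ 2 = 1)
    (h : x * c * x⁻¹ = c⁻¹) (hodd : Odd (orderOf c)) (hc : orderOf c ≠ 1) :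
    Function.Injective (liftOfConjEqInv hx h) := by
  rw [injective_iff_map_eq_one]
  rintro (i | i) hi
  · change c ^ (i.cast : ℤ) = 1 at hi
    rw [← orderOf_dvd_iff_zpow_eq_one, ← ZMod.intCast_zmod_eq_zero_iff_dvd,
      ZMod.intCast_zmod_cast] at hi
    rw [hi, r_zero]
  · exfalso
    change x * c ^ (i.cast : ℤ) = 1 at hi
    have hcomm : Commute x c := by
      rw [eq_inv_of_mul_eq_one_left hi]
      exact ((Commute.refl c).zpow_left _).inv_left
    rw [hcomm.eq, mul_inv_cancel_right, eq_inv_iff_mul_eq_one, ← sq,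
      ← orderOf_dvd_iff_pow_eq_one, Nat.dvd_prime Nat.prime_two] at h
    rcases h with h | h
    · exact hc h
    · rw [h] at hodd
      exact absurd hodd (by decide)

lemma DihedralGroup.range_liftOfConjEqInv {x c : G} (hx : x ^ 2 = 1)
    (h : x * c * x⁻¹ = c⁻¹) : (liftOfConjEqInv hx h).range = zpowers x ⊔ zpowers c := by
  apply le_antisymm
  · rintro _ ⟨i | i, rfl⟩
    · exact mem_sup_right (zpow_mem_zpowers c _)
    · exact mul_mem_sup (mem_zpowers x) (zpow_mem_zpowers c _)
  · rw [sup_le_iff, zpowers_le, zpowers_le]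
    refine ⟨⟨sr 0, ?_⟩, ⟨r 1, ?_⟩⟩
    · change x * c ^ ((0 : ZMod (orderOf c)).cast : ℤ) = x
      simp
    · change c ^ ((1 : ZMod (orderOf c)).cast : ℤ) = c
      conv_rhs => rw [← zpow_one c]
      rw [zpow_eq_zpow_iff_modEq, ← ZMod.intCast_eq_intCast_iff]
      simp

/-- Two involutions whose product has odd order `n ≠ 1` generate a dihedral group of order
`2 * n`. -/
lemma nonempty_closure_pair_mulEquiv_dihedralGroup {x y : G} (hx : x ^ 2 = 1) (hy : y ^ 2 = 1)
    (hodd : Odd (orderOf (x * y))) (hne : orderOf (x * y) ≠ 1) :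
    Nonempty (closure {x, y} ≃* DihedralGroup (orderOf (x * y))) := by
  have h := conj_mul_eq_inv_of_sq_eq_one hx hy
  rw [closure_pair_eq_zpowers_sup_zpowers, ← DihedralGroup.range_liftOfConjEqInv hx h]
  exact ⟨(MonoidHom.ofInjective (DihedralGroup.liftOfConjEqInv_injective hx h hodd hne)).symm⟩

lemma conj_sq_eq_one {x : G} (hx : x ^ 2 = 1) (g : G) : (g⁻¹ * x * g) ^ 2 = 1 := by
  simpa [hx] using conj_pow (i := 2) (a := g⁻¹) (b := x)

/-- An involution outside every normal `2`-subgroup has a conjugate such that the product of the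
two has odd order greater than one. -/
lemma exists_odd_orderOf_mul_conj [Finite G] {x : G} (hx : x ^ 2 = 1)
    (hN : ∀ N : Subgroup G, N.Normal → IsPGroup 2 N → x ∉ N) :
    ∃ g : G, Odd (orderOf (x * (g⁻¹ * x * g))) ∧ 1 < orderOf (x * (g⁻¹ * x * g)) := by
  obtain ⟨g, hg⟩ : ∃ g : G, ¬ IsPGroup 2 (closure {x, g⁻¹ * x * g}) := by
    by_contra! h
    exact hN _ inferInstance (isPGroup_normalClosure_of_isPGroup_closure_pair h)
      (subset_normalClosure rfl)
  have hy := conj_sq_eq_one hx g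
  set c := x * (g⁻¹ * x * g) with hc
  have hinv : x * c * x⁻¹ = c⁻¹ := conj_mul_eq_inv_of_sq_eq_one hx hy
  obtain ⟨a, m, hm, ham⟩ := Nat.exists_eq_two_pow_mul_odd (orderOf_pos c).ne'
  have hx_inv : x⁻¹ = x := inv_eq_of_mul_eq_one_left (by rwa [← sq])
  have hmul : x * ((c ^ 2 ^ a)⁻¹ * x * c ^ 2 ^ a) = c ^ (2 ^ a * 2) := by
    have := conj_zpow_eq_inv hinv (-(2 ^ a : ℕ))
    rw [hx_inv, zpow_neg, neg_neg, zpow_natCast] at this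
    rw [← mul_assoc, ← mul_assoc, this, mul_two, pow_add]
  have hord : orderOf (c ^ (2 ^ a * 2)) = m := by
    rw [orderOf_pow, ham, Nat.gcd_mul_left, hm.coprime_two_right.gcd_eq_one, mul_one,
      Nat.mul_div_cancel_left _ (by positivity)]
  refine ⟨c ^ 2 ^ a, ?_⟩
  rw [hmul, hord]
  refine ⟨hm, lt_of_le_of_ne hm.pos fun h1 => hg ?_⟩
  refine isPGroup_closure_pair_of_sq_eq_one hx hy (k := a) ?_
  rw [← hc, ← orderOf_dvd_iff_pow_eq_one, ham, ← h1, mul_one]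

end Involutions

end BaerSuzuki

theorem baer_suzuki_dihedral (G : Type*) [Group G] [Finite G] (z : G)
    (hz : z ∉ Subgroup.center G) (hz2 : z ^ 2 ∈ Subgroup.center G)
    (hO : ∀ N : Subgroup (G ⧸ Subgroup.center G), N.Normal → IsPGroup 2 N →
      (QuotientGroup.mk z : G ⧸ Subgroup.center G) ∉ N) :
    ∃ (h : G) (n : ℕ), Odd n ∧ 1 < n ∧
      Nonempty (↥(Subgroup.closure
        {(QuotientGroup.mk z : G ⧸ Subgroup.center G),
          (QuotientGroup.mk (h⁻¹ * z * h) : G ⧸ Subgroup.center G)}) ≃* DihedralGroup n) ∧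
      ∀ w ∈ Subgroup.closure
          {(QuotientGroup.mk (z * (h⁻¹ * z * h)) : G ⧸ Subgroup.center G)},
        (QuotientGroup.mk z : G ⧸ Subgroup.center G)⁻¹ * w * QuotientGroup.mk z = w⁻¹ := by
  have hx : (QuotientGroup.mk z : G ⧸ Subgroup.center G) ^ 2 = 1 := by
    rw [← QuotientGroup.mk_pow]
    exact (QuotientGroup.eq_one_iff _).2 hz2
  obtain ⟨g, hodd, hlt⟩ := exists_odd_orderOf_mul_conj hx hO
  obtain ⟨h, rfl⟩ := QuotientGroup.mk_surjective g
  have hy := conj_sq_eq_one hx (h : G ⧸ Subgroup.center G)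
  refine ⟨h, _, hodd, hlt, nonempty_closure_pair_mulEquiv_dihedralGroup hx hy hodd hlt.ne', ?_⟩
  intro w hw
  obtain ⟨k, rfl⟩ := Subgroup.mem_closure_singleton.1 hw
  have hinv : (z : G ⧸ Subgroup.center G)⁻¹ = z := inv_eq_of_mul_eq_one_left (by rwa [← sq])
  have := conj_zpow_eq_inv (conj_mul_eq_inv_of_sq_eq_one hx hy) k
  rw [hinv] at this ⊢
  rw [← zpow_neg]
  exact this
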